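/- Assume in addition that φ is not Lebesgue-almost-everywhere equal to 0. Then the function μ ↦ μ/Ψ(μ) attains its maximum r* on (0,∞); moreover, for every z ∈ ℂ with 0 < |z| ≤ r*, the set {μ > 0 : |z|·Ψ(μ) = μ} is nonempty and has a least element μ_z, and for every measurable Λ ⊆ ℝ^d of finite Lebesgue measure |Λ| one has Σ_{n≥1} (|z|^n/n!) ∫_{Λ^n} |ω^T_n(x_1,…,x_n)| dx_1⋯dx_n ≤ μ_z·|Λ|; in particular the modulus of Σ_{n≥1} (z^n/n!) ∫_{Λ^n} ω^T_n dx is at most μ_z·|Λ|. -/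

import Mathlib

open MeasureTheory ENNReal
open scoped Classical

noncomputable section

/-- Pair weight `w(x,y) = exp(-β φ(x-y))`, with `exp(-(+∞)) = 0`. -/
def pairW {d : ℕ} (β : ℝ) (φ : (Fin d → ℝ) → ℝ≥0∞) (x y : Fin d → ℝ) : ℝ :=
  if φ (x - y) = ∞ then 0 else Real.exp (-(β * (φ (x - y)).toReal))

/-- Truncated weight `ω^T_n`: sum over connected graphs on `{1,…,n}`. -/
def omegaT {S : Type*} (w : S → S → ℝ) (n : ℕ) (x : Fin n → S) : ℝ :=
  ∑ G : SimpleGraph (Fin n),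
    if G.Connected then
      ∏ p ∈ Finset.univ.filter (fun p : Fin n × Fin n => p.1 < p.2 ∧ G.Adj p.1 p.2),
        (w (x p.1) (x p.2) - 1)
    else 0

/-- `φ_n(x; x_1,…,x_n) = Π_i (1 - w(x,x_i)) Π_{i<j} w(x_i,x_j)`. -/
def phiVertex {S : Type*} (w : S → S → ℝ) (n : ℕ) (x : S) (y : Fin n → S) : ℝ :=
  (∏ i, (1 - w x (y i))) *
    ∏ p ∈ Finset.univ.filter (fun p : Fin n × Fin n => p.1 < p.2), w (y p.1) (y p.2)

/-- `g(n) = ∫_{ℝ^{dn}} φ_n(0; x_1,…,x_n) dx`. -/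
def gCoef {d : ℕ} (β : ℝ) (φ : (Fin d → ℝ) → ℝ≥0∞) (n : ℕ) : ℝ≥0∞ :=
  ∫⁻ y : Fin n → Fin d → ℝ, ENNReal.ofReal (phiVertex (pairW β φ) n 0 y)

/-- The vertex sum `Ψ(t) = 1 + Σ_{n≥1} g(n) t^n/n!` (extended to `t ∈ [0,∞]`). -/
def vertexSum {d : ℕ} (β : ℝ) (φ : (Fin d → ℝ) → ℝ≥0∞) (t : ℝ≥0∞) : ℝ≥0∞ :=
  1 + ∑' n : ℕ, gCoef β φ (n + 1) * t ^ (n + 1) / ((n + 1).factorial : ℝ≥0∞)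

section Graphs

variable {V : Type*} [DecidableEq V]

/-- The edges of the complete graph on `S`. -/
def edgesOn (S : Finset V) : Finset (Sym2 V) := S.sym2.filter (fun e => ¬ e.IsDiag)

/-- Reachability through the edges in `A`. -/
def Reaches (A : Finset (Sym2 V)) : V → V → Prop :=
  Relation.ReflTransGen (fun a b => s(a, b) ∈ A)

/-- Sum over the graphs on `Y ∪ I` in which every vertex of `I` is reachable from `Y`. -/
def rootedSum (f : Sym2 V → ℝ) (Y I : Finset V) : ℝ :=
  ∑ A ∈ (edgesOn (Y ∪ I)).powerset,
    if ∀ i ∈ I, ∃ y ∈ Y, Reaches A y i then ∏ e ∈ A, f e else 0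

lemma mem_edgesOn {S : Finset V} {a b : V} :
    s(a, b) ∈ edgesOn S ↔ a ∈ S ∧ b ∈ S ∧ a ≠ b := by
  simp [edgesOn, and_assoc]

/-- The edges joining `x` to the vertices of `N`. -/
def starEdges (x : V) (N : Finset V) : Finset (Sym2 V) := N.image (fun v => s(x, v))

lemma mem_star {x : V} {N : Finset V} {a b : V} :
    s(a, b) ∈ starEdges x N ↔ (a = x ∧ b ∈ N) ∨ (b = x ∧ a ∈ N) := by
  simp only [starEdges, Finset.mem_image, Sym2.eq_iff]
  constructor
  · rintro ⟨v, hv, ⟨rfl, rfl⟩ | ⟨rfl, rfl⟩⟩ <;> simp [hv]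
  · rintro (⟨rfl, h⟩ | ⟨rfl, h⟩)
    · exact ⟨b, h, by simp⟩
    · exact ⟨a, h, by simp⟩

lemma edgesOn_insert {x : V} {S : Finset V} (hx : x ∉ S) :
    edgesOn (insert x S) = edgesOn S ∪ starEdges x S := by
  ext e
  induction e with | _ a b
  simp only [Finset.mem_union, mem_edgesOn, mem_star, Finset.mem_insert]
  grind

lemma disjoint_edgesOn_star {x : V} {S N : Finset V} (hx : x ∉ S) :
    Disjoint (edgesOn S) (starEdges x N) := by
  rw [Finset.disjoint_left]
  intro e
  induction e with | _ a b
  simp only [mem_edgesOn, mem_star]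
  grind

lemma prod_star {x : V} (N : Finset V) (f : Sym2 V → ℝ) :
    ∏ e ∈ starEdges x N, f e = ∏ v ∈ N, f s(x, v) :=
  Finset.prod_image (by intro a _ b _ h; exact Sym2.congr_right.1 h)

lemma sum_powerset_union {α M : Type*} [DecidableEq α] [AddCommMonoid M] {s t : Finset α}
    (h : Disjoint s t) (F : Finset α → M) :
    ∑ A ∈ (s ∪ t).powerset, F A = ∑ A ∈ s.powerset, ∑ B ∈ t.powerset, F (A ∪ B) := by
  induction t using Finset.induction_on generalizing F with
  | empty => simp
  | insert a t ha ih =>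
    rw [Finset.disjoint_insert_right] at h
    rw [Finset.union_insert, Finset.sum_powerset_insert (by simp [h.1, ha]), ih h.2, ih h.2,
      ← Finset.sum_add_distrib]
    refine Finset.sum_congr rfl fun A _ => ?_
    rw [Finset.sum_powerset_insert ha]
    simp [Finset.union_insert]

lemma sum_powerset_star {M : Type*} [AddCommMonoid M] (x : V) (N : Finset V)
    (F : Finset (Sym2 V) → M) :
    ∑ B ∈ (starEdges x N).powerset, F B = ∑ K ∈ N.powerset, F (starEdges x K) := by
  rw [starEdges, Finset.powerset_image, Finset.sum_image]
  · rfl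
  · intro a _ b _ h
    refine Finset.image_injective ?_ h
    intro a b h
    exact Sym2.congr_right.1 h

lemma reaches_insert_iff {x : V} {Y I L K : Finset V} {A : Finset (Sym2 V)} (hxY : x ∉ Y)
    (hxI : x ∉ I) (hL : L ⊆ Y) (hA : A ⊆ edgesOn (Y ∪ I)) :
    (∀ i ∈ I, ∃ y ∈ insert x Y, Reaches (A ∪ starEdges x (L ∪ K)) y i) ↔
      ∀ i ∈ I \ K, ∃ y ∈ Y ∪ K, Reaches A y i := by
  have hmono : ∀ a b, Reaches A a b → Reaches (A ∪ starEdges x (L ∪ K)) a b := fun a b h =>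
    Relation.ReflTransGen.mono (fun _ _ h => Finset.mem_union_left _ h) _ _ h
  have hstar : ∀ k ∈ K, Reaches (A ∪ starEdges x (L ∪ K)) x k := fun k hk =>
    Relation.ReflTransGen.single (Finset.mem_union_right _ (mem_star.2 (by simp [hk])))
  constructor
  · intro h i hi
    rw [Finset.mem_sdiff] at hi
    obtain ⟨y, hy, hr⟩ := h i hi.1
    have key : ∀ v, Reaches (A ∪ starEdges x (L ∪ K)) y v →
        v = x ∨ ∃ u ∈ Y ∪ K, Reaches A u v := by
      intro v hv
      induction hv with
      | refl =>
        rcases Finset.mem_insert.1 hy with rfl | hy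
        · exact Or.inl rfl
        · exact Or.inr ⟨y, Finset.mem_union_left _ hy, Relation.ReflTransGen.refl⟩
      | @tail b c _ hbc ih =>
        rcases Finset.mem_union.1 hbc with hbc | hbc
        · have hb := mem_edgesOn.1 (hA hbc)
          rcases ih with rfl | ⟨u, hu, hub⟩
          · simp [hxY, hxI] at hb
          · exact Or.inr ⟨u, hu, hub.tail hbc⟩
        · rcases mem_star.1 hbc with ⟨-, hc⟩ | ⟨hc, -⟩
          · refine Or.inr ⟨c, ?_, Relation.ReflTransGen.refl⟩
            exact Finset.union_subset_union_left hL hc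
          · exact Or.inl hc
    rcases key i hr with rfl | h
    · exact absurd hi.1 hxI
    · exact h
  · intro h i hi
    by_cases hiK : i ∈ K
    · exact ⟨x, by simp, hstar i hiK⟩
    · obtain ⟨y, hy, hr⟩ := h i (Finset.mem_sdiff.2 ⟨hi, hiK⟩)
      rcases Finset.mem_union.1 hy with hy | hy
      · exact ⟨y, by simp [hy], hmono _ _ hr⟩
      · exact ⟨x, by simp, (hstar y hy).trans (hmono _ _ hr)⟩

lemma rootedSum_insert (f : Sym2 V → ℝ) {x : V} {Y I : Finset V} (hxY : x ∉ Y) (hxI : x ∉ I)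
    (hYI : Disjoint Y I) :
    rootedSum f (insert x Y) I = (∏ y ∈ Y, (1 + f s(x, y))) *
      ∑ K ∈ I.powerset, (∏ k ∈ K, f s(x, k)) * rootedSum f (Y ∪ K) (I \ K) := by
  have hx : x ∉ Y ∪ I := by simp [hxY, hxI]
  have hLK : ∀ L ∈ Y.powerset, ∀ K ∈ I.powerset, Disjoint L K := fun L hL K hK =>
    (hYI.mono_left (Finset.mem_powerset.1 hL)).mono_right (Finset.mem_powerset.1 hK)
  rw [rootedSum, Finset.insert_union, edgesOn_insert hx,
    sum_powerset_union (disjoint_edgesOn_star hx), Finset.sum_comm, sum_powerset_star,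
    sum_powerset_union hYI, Finset.prod_one_add, Finset.sum_mul]
  refine Finset.sum_congr rfl fun L hL => ?_
  rw [Finset.mul_sum]
  refine Finset.sum_congr rfl fun K hK => ?_
  have hK' := Finset.mem_powerset.1 hK
  have hU : Y ∪ K ∪ I \ K = Y ∪ I := by
    rw [Finset.union_assoc, Finset.union_sdiff_of_subset hK']
  rw [rootedSum, hU, Finset.mul_sum, Finset.mul_sum]
  refine Finset.sum_congr rfl fun A hA => ?_
  rw [Finset.mem_powerset] at hA
  simp only [reaches_insert_iff hxY hxI (Finset.mem_powerset.1 hL) hA]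
  split_ifs
  · rw [Finset.prod_union ((disjoint_edgesOn_star hx).mono_left hA), prod_star,
      Finset.prod_union (hLK L hL K hK)]
    ring
  · simp

lemma rootedSum_empty (f : Sym2 V → ℝ) (I : Finset V) :
    rootedSum f ∅ I = if I = ∅ then 1 else 0 := by
  rcases I.eq_empty_or_nonempty with rfl | ⟨i, hi⟩
  · simp [rootedSum, edgesOn]
  · rw [if_neg (Finset.ne_empty_of_mem hi), rootedSum]
    refine Finset.sum_eq_zero fun A _ => if_neg fun h => ?_
    simpa using h i hi

end Graphs

lemma prod_pairs_eq {n : ℕ} (Q : Sym2 (Fin n) → Prop) (F : Sym2 (Fin n) → ℝ) :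
    ∏ p ∈ Finset.univ.filter (fun p : Fin n × Fin n => p.1 < p.2 ∧ Q s(p.1, p.2)),
      F s(p.1, p.2) = ∏ e ∈ (edgesOn Finset.univ).filter Q, F e := by
  refine Finset.prod_bij (fun p _ => s(p.1, p.2)) ?_ ?_ (fun e he => ?_) (fun _ _ => rfl)
  · rintro ⟨a, b⟩ h
    simp only [Finset.mem_filter, Finset.mem_univ, true_and, mem_edgesOn] at h ⊢
    exact ⟨h.1.ne, h.2⟩
  · rintro ⟨a, b⟩ h ⟨a', b'⟩ h' he
    simp only [Finset.mem_filter, Finset.mem_univ, true_and] at h h'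
    simp only [Sym2.eq_iff] at he
    grind
  · induction e with | _ a b
    simp only [Finset.mem_filter, mem_edgesOn, Finset.mem_univ, true_and] at he
    rcases lt_or_gt_of_ne he.1 with h | h
    · exact ⟨(a, b), by simp [h, he.2], rfl⟩
    · exact ⟨(b, a), by simpa [h, Sym2.eq_swap] using he.2, Sym2.eq_swap⟩

section EdgeWeights

variable {V S : Type*} [DecidableEq V]

/-- The pair weights of a configuration `x`, as a function on edges. -/
def edgeWeight (w : S → S → ℝ) (hw : ∀ a b, w a b = w b a) (x : V → S) : Sym2 V → ℝ :=
  Sym2.lift ⟨fun i j => w (x i) (x j), fun _ _ => hw _ _⟩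

@[simp] lemma edgeWeight_mk {V : Type*} (w : S → S → ℝ) (hw : ∀ a b, w a b = w b a) (x : V → S) (i j : V) :
    edgeWeight w hw x s(i, j) = w (x i) (x j) := rfl

/-- The Boltzmann factor of the points of `x` with labels in `Y`. -/
def pairProd (w : S → S → ℝ) (hw : ∀ a b, w a b = w b a) (Y : Finset V) (x : V → S) : ℝ :=
  ∏ e ∈ edgesOn Y, edgeWeight w hw x e

/-- The rooted graph sum with edge factors `w - 1`. -/
def rootedUrsell (w : S → S → ℝ) (hw : ∀ a b, w a b = w b a) (Y I : Finset V) (x : V → S) : ℝ :=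
  rootedSum (fun e => edgeWeight w hw x e - 1) Y I

variable {w : S → S → ℝ} {hw : ∀ a b, w a b = w b a}

lemma pairProd_insert {x : V → S} {a : V} {Y : Finset V} (ha : a ∉ Y) :
    pairProd w hw (insert a Y) x = (∏ y ∈ Y, w (x a) (x y)) * pairProd w hw Y x := by
  rw [pairProd, edgesOn_insert ha, Finset.prod_union (disjoint_edgesOn_star ha), prod_star,
    mul_comm]
  rfl

lemma pairProd_empty (x : V → S) : pairProd w hw ∅ x = 1 := by
  simp [pairProd, edgesOn]

lemma pairProd_singleton (x : V → S) (a : V) : pairProd w hw {a} x = 1 := by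
  rw [← insert_empty_eq, pairProd_insert (by simp), pairProd_empty]
  simp

lemma pairProd_nonneg (h0 : ∀ a b, 0 ≤ w a b) (x : V → S) (Y : Finset V) :
    0 ≤ pairProd w hw Y x := by
  refine Finset.prod_nonneg fun e _ => ?_
  induction e with | _ a b
  exact h0 _ _

lemma pairProd_union_le (h0 : ∀ a b, 0 ≤ w a b) (h1 : ∀ a b, w a b ≤ 1) (x : V → S)
    {Y K : Finset V} (h : Disjoint Y K) :
    pairProd w hw (Y ∪ K) x ≤ pairProd w hw Y x * pairProd w hw K x := by
  have hd : Disjoint (edgesOn Y) (edgesOn K) := by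
    rw [Finset.disjoint_left]
    intro e
    induction e with | _ a b
    simp only [mem_edgesOn]
    exact fun h1 h2 => Finset.disjoint_left.1 h h1.1 h2.1
  unfold pairProd
  rw [← Finset.prod_union hd]
  refine Finset.prod_le_prod_of_subset_of_le_one ?_ ?_ ?_
  all_goals intro e
  all_goals induction e with | _ a b
  · simp only [Finset.mem_union, mem_edgesOn]
    tauto
  · exact fun _ => h0 _ _
  · exact fun _ _ => h1 _ _

lemma pairProd_congr {x x' : V → S} {Y : Finset V} (h : ∀ i ∈ Y, x i = x' i) :
    pairProd w hw Y x = pairProd w hw Y x' := by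
  refine Finset.prod_congr rfl fun e he => ?_
  induction e with | _ a b
  rw [mem_edgesOn] at he
  simp [h a he.1, h b he.2.1]

lemma pairProd_image {V' : Type*} [DecidableEq V'] {e : V' → V} (he : Function.Injective e)
    (Y : Finset V') (x : V → S) :
    pairProd w hw (Y.image e) x = pairProd w hw Y (x ∘ e) := by
  have : edgesOn (Y.image e) = (edgesOn Y).image (Sym2.map e) := by
    ext p
    induction p with | _ a b
    simp only [mem_edgesOn, Finset.mem_image]
    constructor
    · rintro ⟨⟨a, ha, rfl⟩, ⟨b, hb, rfl⟩, h⟩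
      exact ⟨s(a, b), mem_edgesOn.2 ⟨ha, hb, fun h' => h (by rw [h'])⟩, by simp⟩
    · rintro ⟨p, hp, hab⟩
      induction p with | _ a' b'
      rw [mem_edgesOn] at hp
      simp only [Sym2.map_mk, Sym2.eq_iff] at hab
      rcases hab with ⟨rfl, rfl⟩ | ⟨rfl, rfl⟩
      · exact ⟨⟨_, hp.1, rfl⟩, ⟨_, hp.2.1, rfl⟩, fun h => hp.2.2 (he h)⟩
      · exact ⟨⟨_, hp.2.1, rfl⟩, ⟨_, hp.1, rfl⟩, fun h => hp.2.2 (he h.symm)⟩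
  rw [pairProd, this, Finset.prod_image (fun a _ b _ h => Sym2.map.injective he h)]
  refine Finset.prod_congr rfl fun p _ => ?_
  induction p with | _ a b
  rfl

lemma rootedUrsell_insert {x : V → S} {a : V} {Y I : Finset V} (haY : a ∉ Y) (haI : a ∉ I)
    (hYI : Disjoint Y I) :
    rootedUrsell w hw (insert a Y) I x = (∏ y ∈ Y, w (x a) (x y)) *
      ∑ K ∈ I.powerset, (∏ k ∈ K, (w (x a) (x k) - 1)) * rootedUrsell w hw (Y ∪ K) (I \ K) x := by
  simp only [rootedUrsell, rootedSum_insert _ haY haI hYI, edgeWeight_mk, add_sub_cancel]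

lemma phiVertex_eq (n : ℕ) (a : S) (y : Fin n → S) :
    phiVertex w n a y = (∏ i, (1 - w a (y i))) * pairProd w hw Finset.univ y := by
  have := prod_pairs_eq (n := n) (fun _ => True) (edgeWeight w hw y)
  simp only [and_true, Finset.filter_true, edgeWeight_mk] at this
  rw [phiVertex, pairProd, ← this]

lemma reaches_iff_reachable {V : Type*} {G : SimpleGraph V} {A : Finset (Sym2 V)}
    (h : ∀ a b, s(a, b) ∈ A ↔ G.Adj a b) (a b : V) : Reaches A a b ↔ G.Reachable a b := by
  rw [SimpleGraph.reachable_iff_reflTransGen, Reaches]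
  simp only [h]

lemma omegaT_eq_rootedUrsell (n : ℕ) (x : Fin (n + 1) → S) :
    omegaT w (n + 1) x = rootedUrsell w hw {0} (Finset.univ.erase 0) x := by
  rw [omegaT, rootedUrsell, rootedSum]
  have hu : ({0} : Finset (Fin (n + 1))) ∪ Finset.univ.erase 0 = Finset.univ := by
    ext i
    simp
  rw [hu]
  refine Finset.sum_bij' (fun G _ => (edgesOn Finset.univ).filter (· ∈ G.edgeSet))
    (fun A _ => SimpleGraph.fromEdgeSet (A : Set (Sym2 (Fin (n + 1))))) ?_ ?_ ?_ ?_ ?_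
  · intro G _
    simp
  · simp
  · intro G _
    ext a b
    simp only [SimpleGraph.fromEdgeSet_adj, Finset.mem_coe, Finset.mem_filter, mem_edgesOn,
      SimpleGraph.mem_edgeSet, Finset.mem_univ, true_and]
    exact ⟨fun h => h.1.2, fun h => ⟨⟨h.ne, h⟩, h.ne⟩⟩
  · intro A hA
    ext e
    have hA' := Finset.mem_powerset.1 hA
    induction e with | _ a b
    simp only [Finset.mem_filter, mem_edgesOn, SimpleGraph.mem_edgeSet,
      SimpleGraph.fromEdgeSet_adj, Finset.mem_coe]
    exact ⟨fun h => h.2.1, fun h => ⟨mem_edgesOn.1 (hA' h), h, (mem_edgesOn.1 (hA' h)).2.2⟩⟩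
  · intro G _
    have hadj : ∀ a b, s(a, b) ∈ (edgesOn Finset.univ).filter (· ∈ G.edgeSet) ↔ G.Adj a b := by
      intro a b
      simp only [Finset.mem_filter, mem_edgesOn, SimpleGraph.mem_edgeSet, Finset.mem_univ,
        true_and]
      exact ⟨fun h => h.2, fun h => ⟨h.ne, h⟩⟩
    have hc : G.Connected ↔ ∀ i ∈ (Finset.univ : Finset (Fin (n + 1))).erase 0,
        ∃ y ∈ ({0} : Finset (Fin (n + 1))),
          Reaches ((edgesOn Finset.univ).filter (· ∈ G.edgeSet)) y i := by
      simp only [reaches_iff_reachable hadj, Finset.mem_singleton, exists_eq_left,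
        Finset.mem_erase, Finset.mem_univ, and_true]
      constructor
      · exact fun h i _ => h.preconnected 0 i
      · intro h
        have h0 : ∀ i, G.Reachable 0 i := fun i => by
          by_cases hi : i = 0
          · rw [hi]
          · exact h i hi
        exact ⟨fun a b => (h0 a).symm.trans (h0 b)⟩
    simp only [hc]
    split_ifs
    · refine Eq.trans (Finset.prod_congr ?_ fun _ _ => rfl) ((prod_pairs_eq (· ∈ G.edgeSet)
        (fun e => edgeWeight w hw x e - 1)).trans (Finset.prod_congr ?_ fun _ _ => rfl))
      · ext p
        simp
      · ext e
        simp
    · rfl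

end EdgeWeights

lemma enorm_finset_prod {ι : Type*} (s : Finset ι) (f : ι → ℝ) :
    ‖∏ i ∈ s, f i‖ₑ = ∏ i ∈ s, ‖f i‖ₑ := by
  induction s using Finset.induction_on with
  | empty => simp
  | insert a s ha ih => rw [Finset.prod_insert ha, Finset.prod_insert ha, enorm_mul, ih]

section Marginals

variable {V E : Type*} [DecidableEq V] [MeasureSpace E]

lemma lmarginal_congr_fun {s : Finset V} {f g : (V → E) → ℝ≥0∞} {x : V → E}
    (h : ∀ y, f (Function.updateFinset x s y) = g (Function.updateFinset x s y)) :
    lmarginal (fun _ : V => (volume : Measure E)) s f x =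
      lmarginal (fun _ => volume) s g x :=
  lintegral_congr h

lemma lmarginal_mul_left {s : Finset V} {c f : (V → E) → ℝ≥0∞} (x : V → E)
    (hc : ∀ y, c (Function.updateFinset x s y) = c x) (hf : Measurable f) :
    lmarginal (fun _ : V => (volume : Measure E)) s (fun x => c x * f x) x =
      c x * lmarginal (fun _ => volume) s f x := by
  simp only [lmarginal, hc]
  exact lintegral_const_mul _ (hf.comp measurable_updateFinset)

lemma updateFinset_of_notMem {E : Type*} {s : Finset V} (x : V → E) (y : ∀ _ : s, E) {i : V} (hi : i ∉ s) :
    Function.updateFinset x s y i = x i := by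
  simp [Function.updateFinset, hi]

lemma lmarginal_finset_sum {ι : Type*} (T : Finset ι) {s : Finset V} {f : ι → (V → E) → ℝ≥0∞}
    (hf : ∀ i ∈ T, Measurable (f i)) (x : V → E) :
    lmarginal (fun _ : V => (volume : Measure E)) s (fun x => ∑ i ∈ T, f i x) x =
      ∑ i ∈ T, lmarginal (fun _ => volume) s (f i) x :=
  lintegral_finsetSum' _ fun i hi => ((hf i hi).comp measurable_updateFinset).aemeasurable

end Marginals

/-- Symmetric, measurable, translation-invariant pair weights with values in `[0,1]`. -/
structure IsPairWeight {E : Type*} [AddGroup E] [MeasurableSpace E] (w : E → E → ℝ) : Prop where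
  symm : ∀ a b, w a b = w b a
  nonneg : ∀ a b, 0 ≤ w a b
  le_one : ∀ a b, w a b ≤ 1
  measurable : Measurable (fun p : E × E => w p.1 p.2)
  translate : ∀ a b c, w (a + c) (b + c) = w a b

/-- The integral of the vertex function rooted at `0`. -/
def vertexIntegral {E : Type*} [AddGroup E] [MeasureSpace E] (w : E → E → ℝ) (n : ℕ) : ℝ≥0∞ :=
  ∫⁻ y : Fin n → E, ENNReal.ofReal (phiVertex w n 0 y)

/-- Coefficients of the majorant tree series with vertex coefficients `g`:
`N` is the total number of vertices and the second argument is the number of roots. -/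
def forestCoeff (g : ℕ → ℝ≥0∞) : ℕ → ℕ → ℝ≥0∞
  | 0, m => if m = 0 then 1 else 0
  | _ + 1, 0 => 0
  | N + 1, m + 1 => ∑ k ∈ Finset.range (N - m + 1),
      ((N - m).choose k : ℝ≥0∞) * g k * forestCoeff g N (m + k)

section Bound

variable {V E : Type*} [DecidableEq V] [AddGroup E] [MeasureSpace E] {w : E → E → ℝ}

lemma IsPairWeight.measurable_comp (h : IsPairWeight w) {α : Type*} [MeasurableSpace α]
    {f g : α → E} (hf : Measurable f) (hg : Measurable g) :
    Measurable (fun x => w (f x) (g x)) :=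
  h.measurable.comp (hf.prodMk hg)

lemma measurable_edgeWeight {V : Type*} (h : IsPairWeight w) (e : Sym2 V) :
    Measurable (fun x : V → E => edgeWeight w h.symm x e) := by
  induction e with | _ a b
  exact h.measurable_comp (measurable_pi_apply a) (measurable_pi_apply b)

lemma measurable_pairProd (h : IsPairWeight w) (Y : Finset V) :
    Measurable (fun x : V → E => pairProd w h.symm Y x) :=
  Finset.measurable_fun_prod _ fun e _ => measurable_edgeWeight h e

lemma measurable_rootedUrsell (h : IsPairWeight w) (Y I : Finset V) :
    Measurable (fun x : V → E => rootedUrsell w h.symm Y I x) := by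
  unfold rootedUrsell rootedSum
  refine Finset.measurable_fun_sum _ fun A _ => ?_
  split_ifs
  · exact Finset.measurable_fun_prod _ fun e _ => (measurable_edgeWeight h e).sub_const _
  · exact measurable_const

/-- Integrating out the neighbours `K` of the root `a` yields the vertex integral. -/
lemma lmarginal_vertex [MeasurableAdd₂ E] [SigmaFinite (volume : Measure E)]
    [(volume : Measure E).IsAddRightInvariant] (h : IsPairWeight w) {a : V} {K : Finset V}
    (ha : a ∉ K) (x : V → E) :
    lmarginal (fun _ : V => (volume : Measure E)) K
      (fun x => (∏ k ∈ K, ‖w (x a) (x k) - 1‖ₑ) * ‖pairProd w h.symm K x‖ₑ) x =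
      vertexIntegral w K.card := by
  let e : Fin K.card → V := fun i => (K.equivFin.symm i : V)
  have he : Function.Injective e := fun i j hij => K.equivFin.symm.injective (Subtype.ext hij)
  have hK : Finset.univ.image e = K := by
    ext v
    simp only [Finset.mem_image, Finset.mem_univ, true_and]
    constructor
    · rintro ⟨i, rfl⟩
      exact (K.equivFin.symm i).2
    · exact fun hv => ⟨K.equivFin ⟨v, hv⟩, by simp [e]⟩
  let F : (Fin K.card → E) → ℝ≥0∞ := fun y =>
    (∏ i, ‖w (x a) (y i) - 1‖ₑ) * ‖pairProd w h.symm Finset.univ y‖ₑ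
  have hF : Measurable F := by
    refine Measurable.mul (Finset.measurable_fun_prod _ fun i _ => ?_)
      (measurable_pairProd h _).enorm
    exact ((h.measurable_comp measurable_const (measurable_pi_apply i)).sub_const _).enorm
  have h1 : lmarginal (fun _ : V => (volume : Measure E)) K
      (fun x => (∏ k ∈ K, ‖w (x a) (x k) - 1‖ₑ) * ‖pairProd w h.symm K x‖ₑ) x =
      lmarginal (fun _ : V => (volume : Measure E)) (Finset.univ.image e)
        (F ∘ (fun x => x ∘ e)) x := by
    rw [hK]
    refine lmarginal_congr_fun fun y => ?_
    rw [updateFinset_of_notMem _ _ ha]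
    simp only [F, Function.comp]
    have hprod : ∀ z : V → E, ∏ k ∈ K, ‖w (x a) (z k) - 1‖ₑ = ∏ i, ‖w (x a) (z (e i)) - 1‖ₑ :=
      fun z => by
        conv_lhs => rw [← hK]
        exact Finset.prod_image (fun i _ j _ hij => he hij)
    have hpair : ∀ z : V → E, pairProd w h.symm K z = pairProd w h.symm Finset.univ (z ∘ e) :=
      fun z => by
        conv_lhs => rw [← hK]
        exact pairProd_image he _ _
    rw [hprod, hpair]
  rw [h1]
  refine (lmarginal_image (μ := fun _ : V => (volume : Measure E)) he Finset.univ hF x).trans ?_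
  rw [lmarginal_univ]
  change ∫⁻ y : Fin K.card → E, F y = _
  rw [vertexIntegral, ← lintegral_add_right_eq_self F (fun _ => x a)]
  refine lintegral_congr fun y => ?_
  have hw0 : ∀ b, w (x a) (b + x a) = w 0 b := fun b => by
    rw [← h.translate 0 b (x a), zero_add]
  have hp : pairProd w h.symm Finset.univ (y + fun _ => x a) =
      pairProd w h.symm Finset.univ y := by
    refine Finset.prod_congr rfl fun p _ => ?_
    induction p with | _ i j
    simp [h.translate]
  have hn : 0 ≤ phiVertex w K.card 0 y := by
    rw [phiVertex_eq (hw := h.symm)]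
    exact mul_nonneg (Finset.prod_nonneg fun i _ => sub_nonneg.2 (h.le_one _ _))
      (pairProd_nonneg h.nonneg _ _)
  rw [← Real.enorm_of_nonneg hn, phiVertex_eq (hw := h.symm), enorm_mul, enorm_finset_prod]
  simp only [F, hp, Pi.add_apply, hw0]
  congr 1
  exact Finset.prod_congr rfl fun i _ => by rw [← enorm_neg, neg_sub]

theorem lmarginal_rootedUrsell_le [MeasurableAdd₂ E] [SigmaFinite (volume : Measure E)]
    [(volume : Measure E).IsAddRightInvariant] (h : IsPairWeight w) (N : ℕ) (Y I : Finset V)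
    (hYI : Disjoint Y I) (hN : Y.card + I.card = N) (x : V → E) :
    lmarginal (fun _ : V => (volume : Measure E)) I (fun x => ‖rootedUrsell w h.symm Y I x‖ₑ) x
      ≤ ‖pairProd w h.symm Y x‖ₑ * forestCoeff (vertexIntegral w) N Y.card := by
  induction N generalizing Y I x with
  | zero =>
    obtain ⟨hY, hI⟩ : Y = ∅ ∧ I = ∅ := by simpa using hN
    subst hY hI
    simp [rootedUrsell, rootedSum_empty, pairProd_empty, forestCoeff]
  | succ N ih =>
    rcases Y.eq_empty_or_nonempty with rfl | ⟨a, ha⟩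
    · have hI : I ≠ ∅ := by
        rintro rfl
        simp at hN
      simp [rootedUrsell, rootedSum_empty, hI, lmarginal]
    obtain ⟨Y, haY, rfl⟩ : ∃ Y', a ∉ Y' ∧ insert a Y' = Y :=
      ⟨Y.erase a, Finset.notMem_erase _ _, Finset.insert_erase ha⟩
    rw [Finset.disjoint_insert_left] at hYI
    obtain ⟨haI, hYI⟩ := hYI
    rw [Finset.card_insert_of_notMem haY] at hN ⊢
    have hNm : N - Y.card = I.card := by omega
    set c : (V → E) → ℝ≥0∞ := fun x => ∏ y ∈ Y, ‖w (x a) (x y)‖ₑ with hc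
    set T : Finset V → (V → E) → ℝ≥0∞ := fun K x =>
      (∏ k ∈ K, ‖w (x a) (x k) - 1‖ₑ) * ‖rootedUrsell w h.symm (Y ∪ K) (I \ K) x‖ₑ with hT
    have hmprod : ∀ K : Finset V, Measurable
        (fun x : V → E => ∏ k ∈ K, ‖w (x a) (x k) - 1‖ₑ) := fun K =>
      Finset.measurable_fun_prod _ fun i _ =>
        ((h.measurable_comp (measurable_pi_apply a) (measurable_pi_apply i)).sub_const _).enorm
    have hTm : ∀ K, Measurable (T K) := fun K =>
      (hmprod K).mul (measurable_rootedUrsell h _ _).enorm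
    have hpt : (fun x => ‖rootedUrsell w h.symm (insert a Y) I x‖ₑ) ≤
        fun x => c x * ∑ K ∈ I.powerset, T K x := by
      intro x
      dsimp only
      rw [rootedUrsell_insert haY haI hYI, enorm_mul, enorm_finset_prod]
      refine mul_le_mul_right ((enorm_sum_le _ _).trans (le_of_eq ?_)) _
      refine Finset.sum_congr rfl fun K _ => ?_
      rw [enorm_mul, enorm_finset_prod]
    refine (lmarginal_mono hpt x).trans ?_
    rw [lmarginal_mul_left x _ (Finset.measurable_fun_sum _ fun K _ => hTm K),
      lmarginal_finset_sum _ fun K _ => hTm K]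
    swap
    · intro y
      refine Finset.prod_congr rfl fun b hb => ?_
      rw [updateFinset_of_notMem _ _ haI,
        updateFinset_of_notMem _ _ (Finset.disjoint_left.1 hYI hb)]
    rw [pairProd_insert haY, enorm_mul, enorm_finset_prod, mul_assoc]
    refine mul_le_mul_right ?_ _
    have hterm : ∀ K ∈ I.powerset, lmarginal (fun _ : V => (volume : Measure E)) I (T K) x ≤
        ‖pairProd w h.symm Y x‖ₑ *
          (vertexIntegral w K.card * forestCoeff (vertexIntegral w) N (Y.card + K.card)) := by
      intro K hK
      rw [Finset.mem_powerset] at hK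
      have hYK : Disjoint Y K := hYI.mono_right hK
      have haK : a ∉ K := fun h => haI (hK h)
      have hcard : (Y ∪ K).card = Y.card + K.card := Finset.card_union_of_disjoint hYK
      have hdisj : Disjoint (Y ∪ K) (I \ K) :=
        Finset.disjoint_union_left.2 ⟨hYI.mono_right Finset.sdiff_subset, Finset.disjoint_sdiff⟩
      have hcard' : (Y ∪ K).card + (I \ K).card = N := by
        have := Finset.card_sdiff_add_card_eq_card hK
        omega
      set q := forestCoeff (vertexIntegral w) N (Y.card + K.card) with hq
      have hsplit := lmarginal_union (fun _ : V => (volume : Measure E)) (T K) (hTm K)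
        (Finset.disjoint_sdiff (s := K) (t := I))
      rw [Finset.union_sdiff_of_subset hK] at hsplit
      rw [hsplit]
      have hin : lmarginal (fun _ : V => (volume : Measure E)) (I \ K) (T K) ≤ fun x =>
          (‖pairProd w h.symm Y x‖ₑ * q) *
            ((∏ k ∈ K, ‖w (x a) (x k) - 1‖ₑ) * ‖pairProd w h.symm K x‖ₑ) := by
        intro x
        rw [lmarginal_mul_left x _ (measurable_rootedUrsell h _ _).enorm]
        · calc _ ≤ (∏ k ∈ K, ‖w (x a) (x k) - 1‖ₑ) * (‖pairProd w h.symm (Y ∪ K) x‖ₑ * q) := by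
                refine mul_le_mul_right ?_ _
                rw [hq, ← hcard]
                exact ih _ _ hdisj hcard' x
            _ ≤ (∏ k ∈ K, ‖w (x a) (x k) - 1‖ₑ) *
                ((‖pairProd w h.symm Y x‖ₑ * ‖pairProd w h.symm K x‖ₑ) * q) := by
                refine mul_le_mul_right (mul_le_mul_left ?_ _) _
                rw [← enorm_mul, Real.enorm_of_nonneg (pairProd_nonneg h.nonneg _ _),
                  Real.enorm_of_nonneg (mul_nonneg (pairProd_nonneg h.nonneg _ _)
                    (pairProd_nonneg h.nonneg _ _))]
                exact ENNReal.ofReal_le_ofReal (pairProd_union_le h.nonneg h.le_one x hYK)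
            _ = _ := by ring
        · intro y
          refine Finset.prod_congr rfl fun k hk => ?_
          rw [updateFinset_of_notMem _ _ (fun h => haI (Finset.mem_sdiff.1 h).1),
            updateFinset_of_notMem _ _ (fun h => (Finset.mem_sdiff.1 h).2 hk)]
      refine (lmarginal_mono hin x).trans (le_of_eq ?_)
      have hm : Measurable (fun x : V → E =>
          (∏ k ∈ K, ‖w (x a) (x k) - 1‖ₑ) * ‖pairProd w h.symm K x‖ₑ) :=
        (hmprod K).mul (measurable_pairProd h K).enorm
      rw [lmarginal_mul_left (c := fun x => ‖pairProd w h.symm Y x‖ₑ * q) x _ hm,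
        lmarginal_vertex h haK]
      · ring
      · intro y
        rw [pairProd_congr fun i hi =>
          updateFinset_of_notMem x y (Finset.disjoint_left.1 hYK hi)]
    refine (Finset.sum_le_sum hterm).trans (le_of_eq ?_)
    rw [← Finset.mul_sum, Finset.sum_powerset_apply_card
      (fun k => vertexIntegral w k * forestCoeff (vertexIntegral w) N (Y.card + k)),
      forestCoeff, hNm]
    simp only [nsmul_eq_mul, mul_assoc]

end Bound

lemma choose_div_factorial (k j : ℕ) :
    ((k + j).choose k : ℝ≥0∞) / ((k + j).factorial : ℝ≥0∞) =
      1 / (k.factorial : ℝ≥0∞) * (1 / (j.factorial : ℝ≥0∞)) := by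
  have hk : ∀ n : ℕ, (n.factorial : ℝ≥0∞) ≠ 0 := fun n => by
    exact_mod_cast n.factorial_ne_zero
  have ht : ∀ n : ℕ, (n.factorial : ℝ≥0∞) ≠ ∞ := fun n => ENNReal.natCast_ne_top _
  have hfac : (k + j).factorial = (k + j).choose k * k.factorial * j.factorial := by
    rw [Nat.choose_symm_add, Nat.add_choose_mul_factorial_mul_factorial]
  rw [hfac]
  have hc : ((k + j).choose k : ℝ≥0∞) ≠ 0 := by
    exact_mod_cast (Nat.choose_pos (Nat.le_add_right k j)).ne'
  push_cast
  rw [mul_assoc, one_div, one_div, ← ENNReal.mul_inv (Or.inl (hk k)) (Or.inl (ht k)),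
    ENNReal.div_eq_inv_mul, ENNReal.mul_inv (Or.inl hc) (Or.inl (ENNReal.natCast_ne_top _)),
    mul_right_comm, ENNReal.inv_mul_cancel hc (ENNReal.natCast_ne_top _), one_mul]

lemma sum_forestCoeff_le {g : ℕ → ℝ≥0∞} {r t : ℝ≥0∞}
    (h : ∀ N, r * ∑ k ∈ Finset.range N, g k * t ^ k / (k.factorial : ℝ≥0∞) ≤ t) (M m N : ℕ)
    (hM : m + N = M) :
    r ^ m * ∑ n ∈ Finset.range (N + 1),
      r ^ n / (n.factorial : ℝ≥0∞) * forestCoeff g (m + n) m ≤ t ^ m := by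
  induction M generalizing m N with
  | zero =>
    obtain ⟨rfl, rfl⟩ : m = 0 ∧ N = 0 := by omega
    simp [forestCoeff]
  | succ M ih =>
    rcases m with _ | m
    · rw [Finset.sum_eq_single 0]
      · simp [forestCoeff]
      · intro n _ hn
        obtain ⟨n, rfl⟩ := Nat.exists_eq_succ_of_ne_zero hn
        rw [zero_add, forestCoeff, mul_zero]
      · simp
    · let F : ℕ → ℕ → ℝ≥0∞ := fun k j => r ^ (k + j) / ((k + j).factorial : ℝ≥0∞) *
        (((k + j).choose k : ℝ≥0∞) * g k * forestCoeff g (m + (k + j)) (m + k))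
      have h1 : ∀ n ∈ Finset.range (N + 1),
          r ^ n / (n.factorial : ℝ≥0∞) * forestCoeff g (m + 1 + n) (m + 1) =
            ∑ k ∈ Finset.range (n + 1), F k (n - k) := by
        intro n _
        rw [Nat.add_right_comm, forestCoeff, Nat.add_sub_cancel_left, Finset.mul_sum]
        refine Finset.sum_congr rfl fun k hk => ?_
        rw [Finset.mem_range] at hk
        simp only [F, Nat.add_sub_of_le (Nat.le_of_lt_succ hk)]
      rw [Finset.sum_congr rfl h1, Finset.sum_range_diag_flip, Finset.mul_sum]
      have h2 : ∀ k ∈ Finset.range (N + 1),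
          r ^ (m + 1) * ∑ j ∈ Finset.range (N + 1 - k), F k j ≤
            t ^ m * (r * (g k * t ^ k / (k.factorial : ℝ≥0∞))) := by
        intro k hk
        rw [Finset.mem_range] at hk
        have hF : ∀ j, F k j = r ^ k * (g k / (k.factorial : ℝ≥0∞)) *
            (r ^ j / (j.factorial : ℝ≥0∞) * forestCoeff g (m + k + j) (m + k)) := by
          intro j
          have hc := choose_div_factorial k j
          calc F k j = (((k + j).choose k : ℝ≥0∞) / ((k + j).factorial : ℝ≥0∞)) *
              (r ^ (k + j) * (g k * forestCoeff g (m + (k + j)) (m + k))) := by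
                simp only [F, div_eq_mul_inv]
                ring
            _ = _ := by
                rw [hc, ← add_assoc, pow_add]
                simp only [div_eq_mul_inv]
                ring
        simp only [hF]
        rw [← Finset.mul_sum]
        have hih := ih (m + k) (N - k) (by omega)
        rw [show N - k + 1 = N + 1 - k by omega] at hih
        calc _ = r * (g k / (k.factorial : ℝ≥0∞)) * (r ^ (m + k) *
              ∑ j ∈ Finset.range (N + 1 - k),
                r ^ j / (j.factorial : ℝ≥0∞) * forestCoeff g (m + k + j) (m + k)) := by ring
          _ ≤ r * (g k / (k.factorial : ℝ≥0∞)) * t ^ (m + k) := mul_le_mul_right hih _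
          _ = _ := by
              simp only [div_eq_mul_inv]
              ring
      refine (Finset.sum_le_sum h2).trans ?_
      rw [← Finset.mul_sum, ← Finset.mul_sum, pow_succ]
      exact mul_le_mul_right (h _) _

section ClusterBound

variable {E : Type*} [AddGroup E] [MeasureSpace E] [MeasurableAdd₂ E]
  [SigmaFinite (volume : Measure E)] [(volume : Measure E).IsAddRightInvariant] {w : E → E → ℝ}

lemma setLIntegral_omegaT_le (h : IsPairWeight w) (n : ℕ) {Λ : Set E} (hΛ : MeasurableSet Λ) :
    ∫⁻ x in Set.univ.pi (fun _ : Fin (n + 1) => Λ), ‖omegaT w (n + 1) x‖ₑ ≤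
      volume Λ * forestCoeff (vertexIntegral w) (n + 1) 1 := by
  let R : (Fin (n + 1) → E) → ℝ≥0∞ := fun x =>
    ‖rootedUrsell w h.symm {0} (Finset.univ.erase 0) x‖ₑ
  have hR : Measurable R := (measurable_rootedUrsell h _ _).enorm
  let c : (Fin (n + 1) → E) → ℝ≥0∞ := fun x => Λ.indicator 1 (x 0)
  have hc : Measurable c := (measurable_one.indicator hΛ).comp (measurable_pi_apply 0)
  have hle : ∫⁻ x in Set.univ.pi (fun _ : Fin (n + 1) => Λ), ‖omegaT w (n + 1) x‖ₑ ≤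
      ∫⁻ x, c x * R x := by
    rw [← lintegral_indicator (MeasurableSet.univ_pi fun _ => hΛ)]
    refine lintegral_mono fun x => ?_
    by_cases hx : x ∈ Set.univ.pi (fun _ : Fin (n + 1) => Λ)
    · rw [Set.indicator_of_mem hx, omegaT_eq_rootedUrsell (hw := h.symm)]
      simp [c, R, hx 0 (Set.mem_univ _)]
    · rw [Set.indicator_of_notMem hx]
      exact zero_le
  refine hle.trans ?_
  have hcR : Measurable (fun x => c x * R x) := hc.mul hR
  rw [volume_pi, lintegral_eq_lmarginal_univ (fun _ => 0),
    ← Finset.insert_erase (Finset.mem_univ (0 : Fin (n + 1))),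
    Finset.insert_eq, lmarginal_union _ _ hcR (by simp), lmarginal_singleton]
  have hin : ∀ x, lmarginal (fun _ : Fin (n + 1) => (volume : Measure E)) (Finset.univ.erase 0)
      (fun x => c x * R x) x ≤ c x * forestCoeff (vertexIntegral w) (n + 1) 1 := by
    intro x
    rw [lmarginal_mul_left x _ hR]
    · refine mul_le_mul_right ?_ _
      have := lmarginal_rootedUrsell_le h (n + 1) {0} (Finset.univ.erase 0) (by simp)
        (by simp [add_comm]) x
      rwa [pairProd_singleton, enorm_one, one_mul, Finset.card_singleton] at this
    · intro y
      simp only [c]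
      rw [updateFinset_of_notMem _ _ (by simp)]
  refine (lintegral_mono fun y => hin _).trans (le_of_eq ?_)
  simp only [c, Function.update_self]
  rw [lintegral_mul_const _ (measurable_one.indicator hΛ), lintegral_indicator_one hΛ]

/-- The cluster expansion bound under the tree-graph fixed point criterion. -/
theorem tsum_omegaT_le (h : IsPairWeight w) {r t : ℝ≥0∞}
    (hrt : ∀ N, r * ∑ k ∈ Finset.range N, vertexIntegral w k * t ^ k / (k.factorial : ℝ≥0∞) ≤ t)
    {Λ : Set E} (hΛ : MeasurableSet Λ) :
    ∑' n : ℕ, r ^ (n + 1) / ((n + 1).factorial : ℝ≥0∞) *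
      ∫⁻ x in Set.univ.pi (fun _ : Fin (n + 1) => Λ), ‖omegaT w (n + 1) x‖ₑ ≤ t * volume Λ := by
  refine ENNReal.tsum_le_of_sum_range_le fun N => ?_
  have hterm : ∀ n ∈ Finset.range N, r ^ (n + 1) / ((n + 1).factorial : ℝ≥0∞) *
      ∫⁻ x in Set.univ.pi (fun _ : Fin (n + 1) => Λ), ‖omegaT w (n + 1) x‖ₑ ≤
      volume Λ * (r ^ 1 * (r ^ n / (n.factorial : ℝ≥0∞) *
        forestCoeff (vertexIntegral w) (1 + n) 1)) := by
    intro n _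
    calc _ ≤ r ^ (n + 1) / (n.factorial : ℝ≥0∞) *
          (volume Λ * forestCoeff (vertexIntegral w) (n + 1) 1) := by
            refine mul_le_mul' (ENNReal.div_le_div_left ?_ _) (setLIntegral_omegaT_le h n hΛ)
            exact_mod_cast Nat.factorial_le (Nat.le_succ n)
      _ = _ := by
            rw [add_comm 1 n, pow_succ]
            simp only [div_eq_mul_inv]
            ring
  refine (Finset.sum_le_sum hterm).trans ?_
  rw [← Finset.mul_sum, ← Finset.mul_sum, mul_comm t]
  refine mul_le_mul_right ?_ _
  calc _ ≤ r ^ 1 * ∑ n ∈ Finset.range (N + 1), r ^ n / (n.factorial : ℝ≥0∞) *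
        forestCoeff (vertexIntegral w) (1 + n) 1 :=
          mul_le_mul_right (Finset.sum_le_sum_of_subset
            (Finset.range_subset_range.2 (Nat.le_succ N))) _
    _ ≤ t ^ 1 := sum_forestCoeff_le hrt (1 + N) 1 N rfl
    _ = t := pow_one t

end ClusterBound

/-- Maximum of `t / F t` and the least solution of `r * F t = t`. -/
lemma exists_max_div_and_least_fixedPoint {F : ℝ → ℝ} (hF : ContinuousOn F (Set.Ici 0))
    (h1 : ∀ t, 0 ≤ t → 1 ≤ F t) {q : ℝ} (hq : 0 < q) (h2 : ∀ t, 0 ≤ t → q * t ^ 2 ≤ F t) :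
    ∃ m : ℝ, 0 < m ∧ (∀ t, 0 < t → t / F t ≤ m / F m) ∧
      ∀ r, 0 < r → r ≤ m / F m →
        ∃ s, 0 < s ∧ r * F s = s ∧ ∀ s', 0 < s' → r * F s' = s' → s ≤ s' := by
  have hpos : ∀ t, 0 ≤ t → 0 < F t := fun t ht => zero_lt_one.trans_le (h1 t ht)
  have hH : ContinuousOn (fun t => t / F t) (Set.Ici 0) :=
    continuousOn_id.div hF fun t ht => (hpos t ht).ne'
  have hF1 := hpos 1 zero_le_one
  set M : ℝ := max 1 (F 1 / q) with hM
  have hM1 : 1 ≤ M := le_max_left _ _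
  obtain ⟨m, hm, hmax⟩ := (isCompact_Icc (a := (0 : ℝ)) (b := M)).exists_isMaxOn
    ⟨0, by simp [zero_le_one.trans hM1]⟩ (hH.mono fun t ht => ht.1)
  have hm1 : 1 / F 1 ≤ m / F m := hmax ⟨zero_le_one, hM1⟩
  have hm0 : 0 < m := by
    rcases hm.1.eq_or_lt with h | h
    · rw [← h, zero_div] at hm1
      exact absurd hm1 (not_le.2 (by positivity))
    · exact h
  have hmaxall : ∀ t, 0 < t → t / F t ≤ m / F m := by
    intro t ht
    by_cases htM : t ≤ M
    · exact hmax ⟨ht.le, htM⟩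
    · refine le_trans ?_ hm1
      have htq : F 1 ≤ q * t := by
        have : F 1 / q ≤ t := (le_max_right _ _).trans (not_le.1 htM).le
        rw [div_le_iff₀ hq] at this
        linarith
      rw [div_le_div_iff₀ (hpos t ht.le) hF1]
      have := h2 t ht.le
      nlinarith
  refine ⟨m, hm0, hmaxall, fun r hr hrm => ?_⟩
  rw [le_div_iff₀ (hpos m hm0.le)] at hrm
  have hG : ContinuousOn (fun t => r * F t - t) (Set.Icc 0 m) :=
    ((continuousOn_const.mul hF).sub continuousOn_id).mono fun t ht => ht.1
  have hG0 : 0 < r * F 0 - 0 := by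
    have := hpos 0 le_rfl
    simp only [sub_zero]
    positivity
  have hcpt : IsCompact (Set.Icc 0 m ∩ (fun t => r * F t - t) ⁻¹' {0}) :=
    isCompact_Icc.of_isClosed_subset (hG.preimage_isClosed_of_isClosed isClosed_Icc
      isClosed_singleton) Set.inter_subset_left
  have hne : (Set.Icc 0 m ∩ (fun t => r * F t - t) ⁻¹' {0}).Nonempty := by
    obtain ⟨t, ht, ht'⟩ := intermediate_value_Icc' hm0.le hG
      (show (0 : ℝ) ∈ Set.Icc (r * F m - m) (r * F 0 - 0) from ⟨by linarith, hG0.le⟩)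
    exact ⟨t, ht, ht'⟩
  obtain ⟨s, ⟨hs, hs'⟩, hleast⟩ := hcpt.exists_isLeast hne
  have hs'' : r * F s - s = 0 := hs'
  refine ⟨s, ?_, by linarith, fun s' hs0 hs1 => ?_⟩
  · rcases hs.1.eq_or_lt with h | h
    · rw [← h] at hs''
      linarith
    · exact h
  · by_cases h : s' ≤ m
    · exact hleast ⟨⟨hs0.le, h⟩, by simp [hs1]⟩
    · exact hs.2.trans (not_le.1 h).le

/-- A set of positive measure cannot contain, up to null sets, its difference set in a set of
finite measure. -/
lemma not_ae_sub_mem {d : ℕ} [NeZero d] {A B : Set (Fin d → ℝ)} (hA : MeasurableSet A)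
    (hBm : MeasurableSet B) (hneg : ∀ v ∈ A, -v ∈ A) (hBA : B ⊆ A) (hB : volume B < ∞)
    (hA0 : volume A ≠ 0) : ¬ ∀ᵐ x : Fin d → ℝ, ∀ᵐ y : Fin d → ℝ, x ∈ A → y ∈ A → x - y ∈ B := by
  intro hae
  obtain ⟨x, hxA, hx0, hx⟩ : ∃ x ∈ A, x ≠ 0 ∧ ∀ᵐ y : Fin d → ℝ, y ∈ A → x - y ∈ B := by
    by_contra! hcon
    refine hA0 (measure_eq_zero_iff_ae_notMem.2 ?_)
    have h0 : ∀ᵐ x : Fin d → ℝ, x ≠ 0 :=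
      measure_eq_zero_iff_ae_notMem.1 (measure_singleton (0 : Fin d → ℝ))
    filter_upwards [hae, h0] with x hx hx0 hxA
    refine hcon x hxA hx0 ?_
    filter_upwards [hx] with y hy h using h.2 (hy hxA h.1)
  have hAfin : volume A < ∞ := by
    refine lt_of_le_of_lt ?_ hB
    calc volume A ≤ volume ((fun y => x - y) ⁻¹' B) := measure_mono_ae hx
      _ = volume B := by
        exact (Measure.measurePreserving_sub_left volume x).measure_preimage hBm.nullMeasurableSet
  have hshift : ∀ᵐ y : Fin d → ℝ, y ∈ A → y - x ∈ A := by
    filter_upwards [hx] with y hy hyA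
    simpa using hneg _ (hBA (hy hyA))
  have hiter : ∀ n : ℕ, ∀ᵐ y : Fin d → ℝ, y ∈ A → y - n • x ∈ A := by
    intro n
    induction n with
    | zero => simp
    | succ n ih =>
      have := (measurePreserving_sub_right (volume : Measure (Fin d → ℝ))
        (n • x)).quasiMeasurePreserving.ae hshift
      filter_upwards [ih, this] with y h1 h2 hy
      rw [succ_nsmul, ← sub_sub]
      exact h2 (h1 hy)
  obtain ⟨R, hR⟩ : ∃ R : ℕ, volume A / 2 < volume (A ∩ Metric.ball 0 (R : ℝ)) := by
    have hmono : Monotone fun R : ℕ => A ∩ Metric.ball (0 : Fin d → ℝ) (R : ℝ) := fun a b hab =>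
      Set.inter_subset_inter_right _ (Metric.ball_subset_ball (by exact_mod_cast hab))
    have hU : ⋃ R : ℕ, A ∩ Metric.ball (0 : Fin d → ℝ) (R : ℝ) = A := by
      rw [← Set.inter_iUnion, Metric.iUnion_ball_nat, Set.inter_univ]
    have hsup := hmono.measure_iUnion (μ := volume)
    rw [hU] at hsup
    have := ENNReal.half_lt_self hA0 hAfin.ne
    conv_rhs at this => rw [hsup]
    exact lt_iSup_iff.1 this
  obtain ⟨n, hn⟩ := exists_nat_gt (2 * (R : ℝ) / ‖x‖)
  have hnx : 2 * (R : ℝ) < ‖n • x‖ := by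
    rw [div_lt_iff₀ (norm_pos_iff.2 hx0)] at hn
    rwa [← Nat.cast_smul_eq_nsmul ℝ, norm_smul, Real.norm_natCast]
  have hle : volume (A ∩ Metric.ball 0 (R : ℝ)) ≤
      volume (A ∩ Metric.ball (-(n • x)) (R : ℝ)) := by
    calc _ ≤ volume ((fun y => y - n • x) ⁻¹' (A ∩ Metric.ball (-(n • x)) (R : ℝ))) := by
          refine measure_mono_ae ?_
          filter_upwards [hiter n] with y hy hyA
          refine ⟨hy hyA.1, ?_⟩
          have := hyA.2
          simp only [Metric.mem_ball, dist_eq_norm, sub_zero, sub_neg_eq_add,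
            sub_add_cancel] at this ⊢
          exact this
      _ = _ := by
          simp only [sub_eq_add_neg]
          exact measure_preimage_add_right _ _ _
  have hdisj : Disjoint (A ∩ Metric.ball 0 (R : ℝ)) (A ∩ Metric.ball (-(n • x)) (R : ℝ)) := by
    refine (Metric.ball_disjoint_ball ?_).mono Set.inter_subset_right Set.inter_subset_right
    rw [dist_eq_norm, zero_sub, neg_neg]
    linarith
  have htot : volume (A ∩ Metric.ball 0 (R : ℝ)) + volume (A ∩ Metric.ball (-(n • x)) (R : ℝ))
      ≤ volume A := by
    rw [← measure_union hdisj (hA.inter Metric.isOpen_ball.measurableSet)]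
    exact measure_mono (Set.union_subset Set.inter_subset_left Set.inter_subset_left)
  have : volume A < volume A := by
    calc volume A = volume A / 2 + volume A / 2 := (ENNReal.add_halves _).symm
      _ < volume (A ∩ Metric.ball 0 (R : ℝ)) + volume (A ∩ Metric.ball (-(n • x)) (R : ℝ)) :=
        ENNReal.add_lt_add hR (hR.trans_le hle)
      _ ≤ volume A := htot
  exact lt_irrefl _ this

lemma lmarginal_prod_eq_pow {V E : Type*} [DecidableEq V] [MeasureSpace E]
    [SigmaFinite (volume : Measure E)] {h : E → ℝ≥0∞} (hh : Measurable h) (K : Finset V)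
    (x : V → E) :
    lmarginal (fun _ : V => (volume : Measure E)) K (fun x => ∏ k ∈ K, h (x k)) x =
      (∫⁻ y, h y) ^ K.card := by
  have hm : ∀ K : Finset V, Measurable (fun x : V → E => ∏ k ∈ K, h (x k)) := fun K =>
    Finset.measurable_fun_prod _ fun k _ => hh.comp (measurable_pi_apply k)
  induction K using Finset.induction_on generalizing x with
  | empty => simp
  | insert a K ha ih =>
    rw [Finset.card_insert_of_notMem ha, pow_succ', lmarginal_insert _ (hm _) ha,
      ← lintegral_mul_const _ hh]
    refine lintegral_congr fun y => ?_
    simp only [Finset.prod_insert ha]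
    rw [lmarginal_mul_left (c := fun x => h (x a)) _ _ (hm K), ih, Function.update_self]
    intro z
    rw [updateFinset_of_notMem _ _ ha]

lemma lintegral_prod_eq_pow {E : Type*} [MeasureSpace E] [Nonempty E]
    [SigmaFinite (volume : Measure E)] {h : E → ℝ≥0∞} (hh : Measurable h) (n : ℕ) :
    ∫⁻ y : Fin n → E, ∏ i, h (y i) = (∫⁻ y, h y) ^ n := by
  have := lmarginal_prod_eq_pow hh (Finset.univ : Finset (Fin n))
    (fun _ => Classical.arbitrary E)
  rwa [lmarginal_univ, Finset.card_univ, Fintype.card_fin] at this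

section PairPotential

variable {d : ℕ} {β : ℝ} {φ : (Fin d → ℝ) → ℝ≥0∞}

lemma isPairWeight_pairW (hβ : 0 < β) (hφm : Measurable φ) (hφeven : ∀ v, φ (-v) = φ v) :
    IsPairWeight (pairW β φ) where
  symm a b := by
    have : φ (a - b) = φ (b - a) := by rw [← neg_sub, hφeven]
    simp only [pairW, this]
  nonneg a b := by
    unfold pairW
    split_ifs
    · exact le_rfl
    · exact (Real.exp_pos _).le
  le_one a b := by
    unfold pairW
    split_ifs
    · exact zero_le_one
    · rw [Real.exp_le_one_iff, neg_nonpos]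
      positivity
  measurable := by
    unfold pairW
    have hm : Measurable (fun p : (Fin d → ℝ) × (Fin d → ℝ) => φ (p.1 - p.2)) :=
      hφm.comp (measurable_fst.sub measurable_snd)
    refine Measurable.ite (hm (measurableSet_singleton ∞)) measurable_const ?_
    exact (hm.ennreal_toReal.const_mul β).neg.exp
  translate a b c := by simp [pairW]

lemma pairW_eq_zero_iff {a b : Fin d → ℝ} : pairW β φ a b = 0 ↔ φ (a - b) = ∞ := by
  unfold pairW
  split_ifs with h
  · simp [h]
  · simp [h, (Real.exp_pos _).ne']

lemma pairW_lt_one_of_ne_zero (hβ : 0 < β) {a b : Fin d → ℝ} (h : φ (a - b) ≠ 0) :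
    pairW β φ a b < 1 := by
  unfold pairW
  split_ifs with h'
  · exact zero_lt_one
  · have := ENNReal.toReal_pos h h'
    rw [Real.exp_lt_one_iff, neg_lt_zero]
    positivity

lemma gCoef_zero : gCoef β φ 0 = 1 := by
  simpa [gCoef, phiVertex] using
    lintegral_prod_eq_pow (E := Fin d → ℝ) (h := fun _ => 1) measurable_const 0

lemma gCoef_le (hβ : 0 < β) (hφm : Measurable φ) (hφeven : ∀ v, φ (-v) = φ v) (n : ℕ) :
    gCoef β φ n ≤ (∫⁻ v : Fin d → ℝ, ENNReal.ofReal (1 - pairW β φ v 0)) ^ n := by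
  have hw := isPairWeight_pairW hβ hφm hφeven
  have hm : Measurable fun v => ENNReal.ofReal (1 - pairW β φ v 0) :=
    ((hw.measurable_comp measurable_id measurable_const).const_sub 1).ennreal_ofReal
  rw [← lintegral_prod_eq_pow hm]
  refine lintegral_mono fun y => ?_
  have hnn : ∀ i, 0 ≤ 1 - pairW β φ 0 (y i) := fun i => sub_nonneg.2 (hw.le_one _ _)
  simp only [hw.symm _ 0]
  rw [← ENNReal.ofReal_prod_of_nonneg fun i _ => hnn i]
  refine ENNReal.ofReal_le_ofReal (mul_le_of_le_one_right (Finset.prod_nonneg fun i _ => hnn i) ?_)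
  exact Finset.prod_le_one (fun p _ => hw.nonneg _ _) fun p _ => hw.le_one _ _

lemma gCoef_two_ne_zero [NeZero d] (hβ : 0 < β) (hφm : Measurable φ)
    (hφeven : ∀ v, φ (-v) = φ v)
    (hT : ∫⁻ v : Fin d → ℝ, ENNReal.ofReal (1 - pairW β φ v 0) < ∞)
    (hφ0 : ¬ φ =ᵐ[volume] (fun _ => 0)) : gCoef β φ 2 ≠ 0 := by
  intro h0
  have hw := isPairWeight_pairW hβ hφm hφeven
  have hφ2 : ∀ y : Fin 2 → Fin d → ℝ, phiVertex (pairW β φ) 2 0 y =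
      (1 - pairW β φ 0 (y 0)) * (1 - pairW β φ 0 (y 1)) * pairW β φ (y 0) (y 1) := by
    intro y
    have : (Finset.univ.filter fun p : Fin 2 × Fin 2 => p.1 < p.2) = {(0, 1)} := by decide
    simp [phiVertex, this, Fin.prod_univ_two]
  have hm : Measurable fun y : Fin 2 → Fin d → ℝ =>
      ENNReal.ofReal (phiVertex (pairW β φ) 2 0 y) := by
    simp only [hφ2]
    have h1 : ∀ i : Fin 2, Measurable fun y : Fin 2 → Fin d → ℝ => 1 - pairW β φ 0 (y i) :=
      fun i => (hw.measurable_comp measurable_const (measurable_pi_apply i)).const_sub 1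
    exact (((h1 0).mul (h1 1)).mul
      (hw.measurable_comp (measurable_pi_apply 0) (measurable_pi_apply 1))).ennreal_ofReal
  rw [gCoef, lintegral_eq_zero_iff hm] at h0
  have hprod : ∀ᵐ p : (Fin d → ℝ) × (Fin d → ℝ), φ p.1 ≠ 0 → φ p.2 ≠ 0 → φ (p.1 - p.2) = ∞ := by
    have h1 := (volume_preserving_finTwoArrow (Fin d → ℝ)).symm.quasiMeasurePreserving.ae h0
    filter_upwards [h1] with p hp hp1 hp2
    have hp' : phiVertex (pairW β φ) 2 0 (MeasurableEquiv.finTwoArrow.symm p) ≤ 0 := by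
      simpa using hp
    rw [hφ2] at hp'
    have e0 : (MeasurableEquiv.finTwoArrow.symm p : Fin 2 → Fin d → ℝ) 0 = p.1 := rfl
    have e1 : (MeasurableEquiv.finTwoArrow.symm p : Fin 2 → Fin d → ℝ) 1 = p.2 := rfl
    rw [e0, e1] at hp'
    have l1 : pairW β φ 0 p.1 < 1 :=
      pairW_lt_one_of_ne_zero hβ (by rwa [zero_sub, hφeven])
    have l2 : pairW β φ 0 p.2 < 1 :=
      pairW_lt_one_of_ne_zero hβ (by rwa [zero_sub, hφeven])
    rw [← pairW_eq_zero_iff (β := β)]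
    by_contra hne
    have l3 : 0 < pairW β φ p.1 p.2 := lt_of_le_of_ne (hw.nonneg _ _) (Ne.symm hne)
    have := mul_pos (mul_pos (sub_pos.2 l1) (sub_pos.2 l2)) l3
    linarith
  refine not_ae_sub_mem (A := {v | φ v ≠ 0}) (B := {v | φ v = ∞})
    (hφm (measurableSet_singleton 0)).compl (hφm (measurableSet_singleton ∞)) ?_ ?_ ?_ ?_
    (Measure.ae_ae_of_ae_prod hprod)
  · intro v hv
    simpa [hφeven] using hv
  · intro v hv
    simp only [Set.mem_ofPred_eq] at hv ⊢
    simp [hv]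
  · refine lt_of_le_of_lt ?_ hT
    calc volume {v | φ v = ∞} = ∫⁻ v in {v | φ v = ∞}, 1 := by simp
      _ ≤ ∫⁻ v in {v | φ v = ∞}, ENNReal.ofReal (1 - pairW β φ v 0) := by
          refine setLIntegral_mono' (hφm (measurableSet_singleton ∞)) fun v hv => ?_
          rw [pairW_eq_zero_iff.2 (by rwa [sub_zero]), sub_zero, ENNReal.ofReal_one]
      _ ≤ _ := setLIntegral_le_lintegral _ _
  · exact hφ0

end PairPotential

section ExponentialSeries

variable {c : ℕ → ℝ≥0∞} {C : ℝ≥0∞}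

/-- The exponential generating function of `c`, as a real function. -/
def expSeries (c : ℕ → ℝ≥0∞) (t : ℝ) : ℝ :=
  ∑' n : ℕ, (c n).toReal * t ^ n / (n.factorial : ℝ)

lemma expSeries_term_le (hC : C ≠ ∞) (hc : ∀ n, c n ≤ C ^ n) {t M : ℝ} (ht : 0 ≤ t)
    (htM : t ≤ M) (n : ℕ) :
    (c n).toReal * t ^ n / (n.factorial : ℝ) ≤ (C.toReal * M) ^ n / (n.factorial : ℝ) := by
  have : (c n).toReal ≤ C.toReal ^ n := by
    rw [← ENNReal.toReal_pow]
    exact ENNReal.toReal_mono (ENNReal.pow_ne_top hC) (hc n)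
  rw [mul_pow]
  gcongr

lemma summable_expSeries (hC : C ≠ ∞) (hc : ∀ n, c n ≤ C ^ n) {t : ℝ} (ht : 0 ≤ t) :
    Summable fun n : ℕ => (c n).toReal * t ^ n / (n.factorial : ℝ) :=
  Summable.of_nonneg_of_le (fun n => by positivity) (expSeries_term_le hC hc ht le_rfl)
    (Real.summable_pow_div_factorial _)

lemma continuousOn_expSeries (hC : C ≠ ∞) (hc : ∀ n, c n ≤ C ^ n) :
    ContinuousOn (expSeries c) (Set.Ici 0) := by
  intro t ht
  have hcont : ContinuousOn (expSeries c) (Set.Icc 0 (t + 1)) := by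
    refine continuousOn_tsum (fun n => by fun_prop)
      (Real.summable_pow_div_factorial (C.toReal * (t + 1))) fun n s hs => ?_
    have := hs.1
    rw [Real.norm_of_nonneg (by positivity)]
    exact expSeries_term_le hC hc hs.1 hs.2 n
  have ht' : (0 : ℝ) ≤ t := ht
  refine (hcont t ⟨ht', by linarith⟩).mono_of_mem_nhdsWithin ?_
  rw [← Set.Ici_inter_Iic]
  exact Filter.inter_mem self_mem_nhdsWithin
    (mem_nhdsWithin_of_mem_nhds (Iic_mem_nhds (by linarith)))

lemma term_le_expSeries (hC : C ≠ ∞) (hc : ∀ n, c n ≤ C ^ n) {t : ℝ} (ht : 0 ≤ t) (n : ℕ) :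
    (c n).toReal * t ^ n / (n.factorial : ℝ) ≤ expSeries c t :=
  (summable_expSeries hC hc ht).le_tsum n fun m _ => by positivity

lemma ofReal_expSeries (hC : C ≠ ∞) (hc : ∀ n, c n ≤ C ^ n) {t : ℝ} (ht : 0 ≤ t) :
    ENNReal.ofReal (expSeries c t) =
      ∑' n : ℕ, c n * ENNReal.ofReal t ^ n / (n.factorial : ℝ≥0∞) := by
  rw [expSeries, ENNReal.ofReal_tsum_of_nonneg (fun n => by positivity)
    (summable_expSeries hC hc ht)]
  refine tsum_congr fun n => ?_
  have hn : (0 : ℝ) < n.factorial := by exact_mod_cast n.factorial_pos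
  rw [ENNReal.ofReal_div_of_pos hn, ENNReal.ofReal_mul ENNReal.toReal_nonneg,
    ENNReal.ofReal_toReal (ne_top_of_le_ne_top (ENNReal.pow_ne_top hC) (hc n)),
    ENNReal.ofReal_pow ht, ENNReal.ofReal_natCast]

end ExponentialSeries

lemma vertexSum_eq_tsum {d : ℕ} {β : ℝ} {φ : (Fin d → ℝ) → ℝ≥0∞} (t : ℝ≥0∞) :
    vertexSum β φ t = ∑' n : ℕ, gCoef β φ n * t ^ n / (n.factorial : ℝ≥0∞) := by
  rw [tsum_eq_zero_add' ENNReal.summable, vertexSum, gCoef_zero]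
  simp

lemma norm_tsum_integral_le {E : Type*} [MeasureSpace E] {f : ∀ n : ℕ, (Fin (n + 1) → E) → ℝ}
    {Λ : Set E} {z : ℂ} {b : ℝ≥0∞} (hb : b ≠ ∞)
    (h : ∑' n : ℕ, ENNReal.ofReal (‖z‖ ^ (n + 1) / (n + 1).factorial) *
      ∫⁻ x in Set.univ.pi (fun _ : Fin (n + 1) => Λ), ENNReal.ofReal |f n x| ≤ b) :
    ‖∑' n : ℕ, z ^ (n + 1) / ((n + 1).factorial : ℂ) *
      ((∫ x in Set.univ.pi (fun _ : Fin (n + 1) => Λ), f n x : ℝ) : ℂ)‖ ≤ b.toReal := by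
  rw [← toReal_enorm]
  refine ENNReal.toReal_mono hb (le_trans enorm_tsum_le_tsum_enorm
    (le_trans (ENNReal.tsum_le_tsum fun n => ?_) h))
  rw [enorm_mul, ← ofReal_norm, norm_div, norm_pow, Complex.norm_natCast]
  gcongr
  rw [← ofReal_norm, Complex.norm_real, ofReal_norm]
  refine (enorm_integral_le_lintegral_enorm _).trans (le_of_eq ?_)
  simp only [Real.enorm_eq_ofReal_abs]

theorem statement2 {d : ℕ} (hd : 1 ≤ d) (β : ℝ) (hβ : 0 < β)
    (φ : (Fin d → ℝ) → ℝ≥0∞) (hφm : Measurable φ) (hφeven : ∀ v, φ (-v) = φ v)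
    (hT : ∫⁻ v : Fin d → ℝ, ENNReal.ofReal (1 - pairW β φ v 0) < ∞)
    (hφ0 : ¬ φ =ᵐ[volume] (fun _ => 0)) :
    ∃ μstar : ℝ, 0 < μstar ∧
      (∀ μ : ℝ, 0 < μ →
        ENNReal.ofReal μ / vertexSum β φ (ENNReal.ofReal μ)
          ≤ ENNReal.ofReal μstar / vertexSum β φ (ENNReal.ofReal μstar)) ∧
      ∀ z : ℂ, 0 < ‖z‖ →
        ENNReal.ofReal ‖z‖ ≤ ENNReal.ofReal μstar / vertexSum β φ (ENNReal.ofReal μstar) →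
        ∃ μz : ℝ, 0 < μz ∧
          ENNReal.ofReal ‖z‖ * vertexSum β φ (ENNReal.ofReal μz) = ENNReal.ofReal μz ∧
          (∀ μ' : ℝ, 0 < μ' →
            ENNReal.ofReal ‖z‖ * vertexSum β φ (ENNReal.ofReal μ') = ENNReal.ofReal μ' →
            μz ≤ μ') ∧
          ∀ Λ : Set (Fin d → ℝ), MeasurableSet Λ → volume Λ < ∞ →
            (∑' n : ℕ, ENNReal.ofReal (‖z‖ ^ (n + 1) / (n + 1).factorial) *
                ∫⁻ x in Set.univ.pi (fun _ : Fin (n + 1) => Λ),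
                  ENNReal.ofReal |omegaT (pairW β φ) (n + 1) x|
              ≤ ENNReal.ofReal μz * volume Λ) ∧
            ‖∑' n : ℕ, z ^ (n + 1) / ((n + 1).factorial : ℂ) *
                ((∫ x in Set.univ.pi (fun _ : Fin (n + 1) => Λ),
                  omegaT (pairW β φ) (n + 1) x : ℝ) : ℂ)‖
              ≤ μz * (volume Λ).toReal := by
  have : NeZero d := ⟨by omega⟩
  have hc := gCoef_le hβ hφm hφeven
  have hq : 0 < (gCoef β φ 2).toReal / 2 := by
    refine half_pos (ENNReal.toReal_pos (gCoef_two_ne_zero hβ hφm hφeven hT hφ0) ?_)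
    exact ne_top_of_le_ne_top (ENNReal.pow_ne_top hT.ne) (hc 2)
  have hF1 : ∀ t, 0 ≤ t → 1 ≤ expSeries (gCoef β φ) t := fun t ht => by
    simpa [gCoef_zero] using term_le_expSeries hT.ne hc ht 0
  have hV : ∀ t, 0 ≤ t → vertexSum β φ (ENNReal.ofReal t) =
      ENNReal.ofReal (expSeries (gCoef β φ) t) := fun t ht => by
    rw [vertexSum_eq_tsum, ofReal_expSeries hT.ne hc ht]
  have hdiv : ∀ t, 0 ≤ t → ENNReal.ofReal t / vertexSum β φ (ENNReal.ofReal t) =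
      ENNReal.ofReal (t / expSeries (gCoef β φ) t) := fun t ht => by
    rw [hV t ht, ENNReal.ofReal_div_of_pos (zero_lt_one.trans_le (hF1 t ht))]
  obtain ⟨m, hm0, hm, hfix⟩ := exists_max_div_and_least_fixedPoint
    (continuousOn_expSeries hT.ne hc) hF1 hq fun t ht => by
      refine le_trans (le_of_eq ?_) (term_le_expSeries hT.ne hc ht 2)
      rw [Nat.factorial_two, Nat.cast_two]
      ring
  have hmF := hF1 m hm0.le
  have heq : ∀ (z : ℂ) (t : ℝ), 0 ≤ t →
      (ENNReal.ofReal ‖z‖ * vertexSum β φ (ENNReal.ofReal t) = ENNReal.ofReal t ↔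
        ‖z‖ * expSeries (gCoef β φ) t = t) := fun z t ht => by
    have := hF1 t ht
    rw [hV t ht, ← ENNReal.ofReal_mul (norm_nonneg z),
      ENNReal.ofReal_eq_ofReal_iff (by positivity) ht]
  refine ⟨m, hm0, fun t ht => ?_, fun z hz hzm => ?_⟩
  · rw [hdiv t ht.le, hdiv m hm0.le]
    exact ENNReal.ofReal_le_ofReal (hm t ht)
  rw [hdiv m hm0.le, ENNReal.ofReal_le_ofReal_iff (by positivity)] at hzm
  obtain ⟨s, hs0, hs, hleast⟩ := hfix ‖z‖ hz hzm
  refine ⟨s, hs0, (heq z s hs0.le).2 hs, fun s' h0 h => hleast s' h0 ((heq z s' h0.le).1 h),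
    fun Λ hΛ hΛf => ?_⟩
  have hbound : ∑' n : ℕ, ENNReal.ofReal (‖z‖ ^ (n + 1) / (n + 1).factorial) *
      ∫⁻ x in Set.univ.pi (fun _ : Fin (n + 1) => Λ),
        ENNReal.ofReal |omegaT (pairW β φ) (n + 1) x| ≤ ENNReal.ofReal s * volume Λ := by
    have key := tsum_omegaT_le (isPairWeight_pairW hβ hφm hφeven) (r := ENNReal.ofReal ‖z‖)
      (t := ENNReal.ofReal s) (fun N => ?_) hΛ
    · refine le_trans (le_of_eq (tsum_congr fun n => ?_)) key
      rw [ENNReal.ofReal_div_of_pos (by positivity), ENNReal.ofReal_pow (norm_nonneg z),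
        ENNReal.ofReal_natCast]
      simp only [Real.enorm_eq_ofReal_abs]
    · refine le_trans ?_ ((heq z s hs0.le).2 hs).le
      rw [vertexSum_eq_tsum]
      gcongr
      exact ENNReal.sum_le_tsum _
  refine ⟨hbound, ?_⟩
  have := norm_tsum_integral_le (ENNReal.mul_ne_top ENNReal.ofReal_ne_top hΛf.ne) hbound
  rwa [ENNReal.toReal_mul, ENNReal.toReal_ofReal hs0.le] at this
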